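/- Let T be a tournament on n players with n a power of two, let M be its skew-symmetric game matrix (M_{uv} = 1 if u beats v, M_{uv} = −1 if v beats u, M_{vv} = 0), and let q be a maximal lottery of T, i.e., a probability vector such that (qᵀM)_j ≥ 0 for every player j. Then every player in the support of q whose out-degree is maximal among the players in the support of q is an SE winner of T. -/

import Mathlib

/-- A tournament relation on `V`: irreflexive, asymmetric, and total. -/
structure IsTournament {V : Type*} (beats : V → V → Prop) : Prop where
  irrefl : ∀ v, ¬ beats v v
  asymm : ∀ u v, beats u v → ¬ beats v u
  total : ∀ u v, u ≠ v → beats u v ∨ beats v u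

/-- `SEWinner beats S v` : the player `v` can win a balanced single-elimination
tournament among the players of `S` under some seeding.  Either `S = {v}`, or `S`
can be partitioned into pairs (via a fixed-point-free involution `f` of `S`) such
that `v` is an SE winner of the set `W` of winners of the pairs. -/
inductive SEWinner {V : Type*} (beats : V → V → Prop) : Finset V → V → Prop
  | single (v : V) : SEWinner beats {v} v
  | round (S W : Finset V) (f : V → V) (v : V)
      (hf : ∀ x ∈ S, f x ∈ S ∧ f x ≠ x ∧ f (f x) = x)
      (hW : ∀ x, x ∈ W ↔ x ∈ S ∧ beats x (f x))
      (hw : SEWinner beats W v) : SEWinner beats S v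

/-- A king: every other player is beaten by `v` or by someone `v` beats. -/
def IsKing {V : Type*} (beats : V → V → Prop) (v : V) : Prop :=
  ∀ u, u ≠ v → beats v u ∨ ∃ w, beats v w ∧ beats w u

/-- A 3-king: every other player is reachable from `v` in at most 3 steps. -/
def IsThreeKing {V : Type*} (beats : V → V → Prop) (v : V) : Prop :=
  ∀ u, u ≠ v → beats v u ∨ (∃ w, beats v w ∧ beats w u) ∨
    ∃ w x, beats v w ∧ beats w x ∧ beats x u

/-- The out-degree of a player. -/
noncomputable def outDeg {V : Type*} [Fintype V] (beats : V → V → Prop) (v : V) : ℕ :=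
  {u | beats v u}.ncard

/-- The number of directed `k`-paths originating at `v`. -/
noncomputable def kPathCount {V : Type*} [Fintype V] (beats : V → V → Prop) (k : ℕ) (v : V) : ℕ :=
  {p : Fin (k + 1) → V | Function.Injective p ∧ p 0 = v ∧
    ∀ i : Fin k, beats (p i.castSucc) (p i.succ)}.ncard

/-- A superking: a king `v` such that every player beating `v` is beaten by at
least `log₂ n` players whom `v` beats. -/
def IsSuperking {V : Type*} [Fintype V] (beats : V → V → Prop) (v : V) : Prop :=
  IsKing beats v ∧ ∀ u, beats u v →
    Real.logb 2 (Fintype.card V) ≤ ({w | beats v w ∧ beats w u}.ncard : ℝ)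


/-- A single round: `S` is partitioned into pairs and `W` is the set of winners. -/
inductive Rnd {V : Type*} [DecidableEq V] (beats : V → V → Prop) : Finset V → Finset V → Prop
  | nil : Rnd beats ∅ ∅
  | cons (a b : V) (S W : Finset V) (h : Rnd beats S W) (hab : beats a b) (hne : a ≠ b)
      (ha : a ∉ S) (hb : b ∉ S) : Rnd beats (insert a (insert b S)) (insert a W)

section helpers
variable {V : Type*} [DecidableEq V] {beats : V → V → Prop}

lemma Rnd.sub {S W : Finset V} (h : Rnd beats S W) : W ⊆ S := by
  induction h with
  | nil => simp
  | cons a b S W h hab hne ha hb ih =>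
    intro x hx
    simp only [Finset.mem_insert] at hx ⊢
    rcases hx with hx | hx
    · exact Or.inl hx
    · exact Or.inr (Or.inr (ih hx))

lemma Rnd.card {S W : Finset V} (h : Rnd beats S W) : 2 * W.card = S.card := by
  induction h with
  | nil => simp
  | cons a b S W h hab hne ha hb ih =>
    rw [Finset.card_insert_of_notMem (fun hx => ha (h.sub hx)),
      Finset.card_insert_of_notMem (by simp [hne, ha]), Finset.card_insert_of_notMem hb]
    omega

lemma Rnd.union {S W S' W' : Finset V} (h : Rnd beats S W) (h' : Rnd beats S' W')
    (hd : Disjoint S S') : Rnd beats (S ∪ S') (W ∪ W') := by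
  induction h with
  | nil => simpa using h'
  | cons a b S W h hab hne ha hb ih =>
    simp only [Finset.disjoint_insert_left] at hd
    rw [Finset.insert_union, Finset.insert_union, Finset.insert_union]
    exact Rnd.cons a b _ _ (ih hd.2.2) hab hne (by simp [ha, hd.1]) (by simp [hb, hd.2.1])

lemma Rnd.exists_fun (hT : IsTournament beats) {S W : Finset V} (h : Rnd beats S W) :
    ∃ f : V → V, (∀ x ∈ S, f x ∈ S ∧ f x ≠ x ∧ f (f x) = x) ∧
      (∀ x, x ∈ W ↔ x ∈ S ∧ beats x (f x)) := by
  induction h with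
  | nil => exact ⟨id, by simp, by simp⟩
  | cons a b S W h hab hne ha hb ih =>
    obtain ⟨f, hf, hW⟩ := ih
    have hba := hT.asymm _ _ hab
    refine ⟨fun x => if x = a then b else if x = b then a else f x, ?_, ?_⟩
    · intro x hx
      simp only [Finset.mem_insert] at hx
      by_cases hxa : x = a
      · subst hxa; simp [hne.symm]
      by_cases hxb : x = b
      · subst hxb; simp [hne, hne.symm]
      have hxS : x ∈ S := by tauto
      obtain ⟨h1, h2, h3⟩ := hf x hxS
      have h4 : f x ≠ a := fun e => ha (e ▸ h1)
      have h5 : f x ≠ b := fun e => hb (e ▸ h1)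
      simp [hxa, hxb, h1, h2, h3, h4, h5]
    · intro x
      by_cases hxa : x = a
      · subst hxa; simp [hab]
      by_cases hxb : x = b
      · subst hxb
        have : x ∉ W := fun hx => hb (h.sub hx)
        simp [hne.symm, hba, this]
      simp [hxa, hxb, hW]

lemma Rnd.pair {a b : V} (hT : IsTournament beats) (hab : beats a b) :
    Rnd beats {a, b} {a} := by
  have hne : a ≠ b := fun e => hT.irrefl b (e ▸ hab)
  have := Rnd.cons (beats := beats) a b ∅ ∅ Rnd.nil hab hne (by simp) (by simp)
  simpa using this

lemma exists_rnd_even (hT : IsTournament beats) (m : ℕ) :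
    ∀ S : Finset V, S.card = 2 * m → ∃ W, Rnd beats S W := by
  induction m with
  | zero =>
    intro S hS
    have : S = ∅ := Finset.card_eq_zero.mp (by omega)
    subst this
    exact ⟨∅, Rnd.nil⟩
  | succ m ih =>
    intro S hS
    obtain ⟨a, ha, b, hb, hne⟩ := Finset.one_lt_card.mp (show 1 < S.card by omega)
    have hsub : ({a, b} : Finset V) ⊆ S := by
      intro x hx
      simp only [Finset.mem_insert, Finset.mem_singleton] at hx
      rcases hx with rfl | rfl <;> assumption
    have hc := Finset.card_sdiff_of_subset hsub
    rw [Finset.card_pair hne] at hc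
    obtain ⟨W, hW⟩ := ih (S \ {a, b}) (by omega)
    have hp : ∃ W', Rnd beats {a, b} W' := by
      rcases hT.total a b hne with h | h
      · exact ⟨_, Rnd.pair hT h⟩
      · rw [Finset.pair_comm]; exact ⟨_, Rnd.pair hT h⟩
    obtain ⟨W', hW'⟩ := hp
    refine ⟨W' ∪ W, ?_⟩
    have := hW'.union hW Finset.disjoint_sdiff
    rwa [Finset.union_sdiff_of_subset hsub] at this

lemma exists_rnd_two (hT : IsTournament beats) (P Q : Finset V) (hd : Disjoint P Q)
    (he : Even (P.card + Q.card)) (hQP : ∀ b ∈ Q, ∀ a ∈ P, beats b a) :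
    ∃ WP WQ, WP ⊆ P ∧ WQ ⊆ Q ∧ Rnd beats (P ∪ Q) (WP ∪ WQ) ∧
      P.card ≤ 2 * WP.card + 1 ∧ 2 * WQ.card ≤ Q.card + 1 := by
  rcases Nat.even_or_odd' P.card with ⟨p, hp | hp⟩
  · obtain ⟨q, hq⟩ : ∃ q, Q.card = 2 * q := by
      obtain ⟨r, hr⟩ := he
      exact ⟨r - p, by omega⟩
    obtain ⟨WP, hWP⟩ := exists_rnd_even hT p P hp
    obtain ⟨WQ, hWQ⟩ := exists_rnd_even hT q Q hq
    have h1 := hWP.card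
    have h2 := hWQ.card
    exact ⟨WP, WQ, hWP.sub, hWQ.sub, hWP.union hWQ hd, by omega, by omega⟩
  · obtain ⟨q, hq⟩ : ∃ q, Q.card = 2 * q + 1 := by
      obtain ⟨r, hr⟩ := he
      exact ⟨r - p - 1, by omega⟩
    obtain ⟨a, ha⟩ := Finset.card_pos.mp (show 0 < P.card by omega)
    obtain ⟨b, hb⟩ := Finset.card_pos.mp (show 0 < Q.card by omega)
    have hcP := Finset.card_erase_of_mem ha
    have hcQ := Finset.card_erase_of_mem hb
    obtain ⟨WP, hWP⟩ := exists_rnd_even hT p (P.erase a) (by omega)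
    obtain ⟨WQ, hWQ⟩ := exists_rnd_even hT q (Q.erase b) (by omega)
    have h1 := hWP.card
    have h2 := hWQ.card
    have hd' : Disjoint (P.erase a) (Q.erase b) :=
      hd.mono (Finset.erase_subset _ _) (Finset.erase_subset _ _)
    have haQ : a ∉ Q := fun h => Finset.disjoint_left.mp hd ha h
    have hbP : b ∉ P := fun h => Finset.disjoint_left.mp hd h hb
    have hne : b ≠ a := fun e => haQ (e ▸ hb)
    have hR := Rnd.cons b a _ _ (hWP.union hWQ hd') (hQP b hb a ha) hne
      (by simp [hbP]) (by simp [haQ])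
    have e1 : insert b (insert a (P.erase a ∪ Q.erase b)) = P ∪ Q := by
      ext x
      simp only [Finset.mem_insert, Finset.mem_union, Finset.mem_erase]
      by_cases hxa : x = a
      · subst hxa; simp [ha]
      by_cases hxb : x = b
      · subst hxb; simp [hb]
      simp [hxa, hxb]
    rw [e1, ← Finset.union_insert] at hR
    refine ⟨WP, insert b WQ, hWP.sub.trans (Finset.erase_subset _ _), ?_, hR, by omega, ?_⟩
    · exact Finset.insert_subset hb (hWQ.sub.trans (Finset.erase_subset _ _))
    · have := Finset.card_insert_le b WQ
      omega

/-- A maximal matching from `A` to `B`. -/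
lemma exists_max_matching (A B : Finset V) (hd : Disjoint A B) :
    ∃ A0 B0, A0 ⊆ A ∧ B0 ⊆ B ∧ A0.card = B0.card ∧ Rnd beats (A0 ∪ B0) A0 ∧
      ∀ a ∈ A \ A0, ∀ b ∈ B \ B0, ¬ beats a b := by
  classical
  let F : Finset (Finset V × Finset V) := (A.powerset ×ˢ B.powerset).filter
    (fun p => p.1.card = p.2.card ∧ Rnd beats (p.1 ∪ p.2) p.1)
  have hF : F.Nonempty := ⟨(∅, ∅), by simp [F, Rnd.nil]⟩
  obtain ⟨⟨A0, B0⟩, hm, hmax⟩ := Finset.exists_max_image F (fun p => p.1.card) hF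
  simp only [F, Finset.mem_filter, Finset.mem_product, Finset.mem_powerset] at hm
  obtain ⟨⟨hA, hB⟩, hc, hR⟩ := hm
  refine ⟨A0, B0, hA, hB, hc, hR, ?_⟩
  intro a ha b hb hab
  simp only [Finset.mem_sdiff] at ha hb
  have haB : a ∉ B := fun h => Finset.disjoint_left.mp hd ha.1 h
  have hbA : b ∉ A := fun h => Finset.disjoint_left.mp hd h hb.1
  have hne : a ≠ b := fun e => haB (e ▸ hb.1)
  have hR' := Rnd.cons a b _ _ hR hab hne
    (by simp only [Finset.mem_union, not_or]; exact ⟨ha.2, fun h => haB (hB h)⟩)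
    (by simp only [Finset.mem_union, not_or]; exact ⟨fun h => hbA (hA h), hb.2⟩)
  rw [← Finset.union_insert, ← Finset.insert_union] at hR'
  have := hmax (insert a A0, insert b B0) (by
    simp only [F, Finset.mem_filter, Finset.mem_product, Finset.mem_powerset]
    refine ⟨⟨Finset.insert_subset ha.1 hA, Finset.insert_subset hb.1 hB⟩, ?_, hR'⟩
    rw [Finset.card_insert_of_notMem ha.2, Finset.card_insert_of_notMem hb.2, hc])
  simp only [Finset.card_insert_of_notMem ha.2] at this
  omega

/-- A king beating at least half of the others is an SE winner. -/
lemma king_wins (hT : IsTournament beats) (K : V) (k : ℕ) :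
    ∀ A B : Finset V, Disjoint A B → K ∉ A → K ∉ B → (∀ a ∈ A, beats K a) →
      (∀ b ∈ B, ∃ a ∈ A, beats a b) → B.card ≤ A.card → A.card + B.card + 1 = 2 ^ k →
      SEWinner beats (insert K (A ∪ B)) K := by
  induction k with
  | zero =>
    intro A B _ _ _ _ _ _ hc
    have hA : A = ∅ := Finset.card_eq_zero.mp (by rw [pow_zero] at hc; omega)
    have hB : B = ∅ := Finset.card_eq_zero.mp (by rw [pow_zero] at hc; omega)
    subst hA hB
    simpa using SEWinner.single K
  | succ k ih =>
    intro A B hd hKA hKB hA hB hle hc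
    rw [pow_succ] at hc
    obtain ⟨A0, B0, hA0, hB0, hc0, hR0, hmx⟩ := exists_max_matching (beats := beats) A B hd
    have hcA := Finset.card_sdiff_of_subset hA0
    have hcB := Finset.card_sdiff_of_subset hB0
    have hlA := Finset.card_le_card hA0
    have hlB := Finset.card_le_card hB0
    obtain ⟨a0, ha0⟩ := Finset.card_pos.mp (show 0 < (A \ A0).card by omega)
    have hcP := Finset.card_erase_of_mem ha0
    have ha0' := Finset.mem_sdiff.mp ha0
    set P := (A \ A0).erase a0 with hP
    set Q := B \ B0 with hQ
    have hPA : P ⊆ A := (Finset.erase_subset _ _).trans Finset.sdiff_subset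
    have hQB : Q ⊆ B := Finset.sdiff_subset
    have hPA0 : Disjoint P A0 :=
      Finset.disjoint_of_subset_left (Finset.erase_subset _ _) Finset.sdiff_disjoint
    have hQB0 : Disjoint Q B0 := Finset.sdiff_disjoint
    have hmem : ∀ x ∈ A, x ∉ B := fun x h1 h2 => Finset.disjoint_left.mp hd h1 h2
    obtain ⟨WP, WQ, hWP, hWQ, hR1, hi1, hi2⟩ := exists_rnd_two hT P Q (hd.mono hPA hQB)
      ⟨2 ^ k - 1 - A0.card, by omega⟩ (by
        intro b hb a ha
        have hne : b ≠ a := fun e => hmem a (hPA ha) (hQB (e ▸ hb))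
        rcases hT.total b a hne with h | h
        · exact h
        · exact absurd h (hmx a (Finset.mem_of_mem_erase ha) b hb))
    have hdis : Disjoint (A0 ∪ B0) (P ∪ Q) := by
      rw [Finset.disjoint_union_left, Finset.disjoint_union_right, Finset.disjoint_union_right]
      exact ⟨⟨hPA0.symm, hd.mono hA0 hQB⟩, (hd.mono hPA hB0).symm, hQB0.symm⟩
    have hR2 := hR0.union hR1 hdis
    have ha0B := hmem a0 ha0'.1
    have hne : K ≠ a0 := fun e => hKA (e ▸ ha0'.1)
    have hR3 := Rnd.cons K a0 _ _ hR2 (hA a0 ha0'.1) hne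
      (by
        simp only [Finset.mem_union, not_or]
        exact ⟨⟨fun h => hKA (hA0 h), fun h => hKB (hB0 h)⟩,
          fun h => hKA (hPA h), fun h => hKB (hQB h)⟩)
      (by
        simp only [Finset.mem_union, not_or]
        exact ⟨⟨ha0'.2, fun h => ha0B (hB0 h)⟩,
          by simp [hP], fun h => ha0B (hQB h)⟩)
    have e1 : insert K (insert a0 (A0 ∪ B0 ∪ (P ∪ Q))) = insert K (A ∪ B) := by
      congr 1
      ext x
      simp only [hP, hQ, Finset.mem_insert, Finset.mem_union, Finset.mem_erase,
        Finset.mem_sdiff]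
      have h1 := @hA0 x
      have h2 := @hB0 x
      by_cases hxa : x = a0
      · subst hxa; simp [ha0'.1]
      by_cases hx1 : x ∈ A0
      · simp [hx1, h1 hx1]
      by_cases hx2 : x ∈ B0
      · simp [hx2, h2 hx2]
      simp [hxa, hx1, hx2]
    have e2 : insert K (A0 ∪ (WP ∪ WQ)) = insert K ((A0 ∪ WP) ∪ WQ) := by
      rw [Finset.union_assoc]
    rw [e1, e2] at hR3
    obtain ⟨f, hf, hW⟩ := hR3.exists_fun hT
    refine SEWinner.round _ _ f K hf hW ?_
    have hAW : A0 ∪ WP ⊆ A := Finset.union_subset hA0 (hWP.trans hPA)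
    have hBW : WQ ⊆ B := hWQ.trans hQB
    have hcu : (A0 ∪ WP).card = A0.card + WP.card :=
      Finset.card_union_of_disjoint (hPA0.symm.mono_right hWP)
    have hking : ∀ b ∈ Q, ∃ a ∈ A0, beats a b := by
      intro b hb
      obtain ⟨a, ha, hab⟩ := hB b (hQB hb)
      by_contra hcon
      push Not at hcon
      have haA0 : a ∉ A0 := fun h => hcon a h hab
      exact hmx a (Finset.mem_sdiff.mpr ⟨ha, haA0⟩) b hb hab
    have hcR := hR1.card
    rw [Finset.card_union_of_disjoint (hd.mono hPA hQB),
      Finset.card_union_of_disjoint (hd.mono (hWP.trans hPA) hBW)] at hcR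
    refine ih (A0 ∪ WP) WQ (hd.mono hAW hBW) (fun h => hKA (hAW h)) (fun h => hKB (hBW h))
      (fun a ha => hA a (hAW ha)) ?_ ?_ (by omega)
    · intro b hb
      obtain ⟨a, ha, hab⟩ := hking b (hWQ hb)
      exact ⟨a, Finset.mem_union_left _ ha, hab⟩
    · rcases WQ.eq_empty_or_nonempty with h | ⟨b, hb⟩
      · simp [h]
      · obtain ⟨a, ha, -⟩ := hking b (hWQ hb)
        have := Finset.card_pos.mpr ⟨a, ha⟩
        omega

end helpers

/-- every player of maximal out-degree in the support of a maximal
lottery (the bipartisan set) is an SE winner. -/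
theorem bipartisan_max_copeland_SE_winner {V : Type*} [Fintype V]
    (beats : V → V → Prop) [DecidableRel beats] (hT : IsTournament beats)
    (k : ℕ) (hcard : Fintype.card V = 2 ^ k)
    (M : Matrix V V ℝ)
    (hM : ∀ u v : V, M u v = if beats u v then 1 else if beats v u then -1 else 0)
    (q : V → ℝ) (hq0 : ∀ i, 0 ≤ q i) (hq1 : ∑ i, q i = 1)
    (hml : ∀ j : V, 0 ≤ ∑ u, q u * M u j)
    (i : V) (hi : 0 < q i)
    (hmax : ∀ j : V, 0 < q j → outDeg beats j ≤ outDeg beats i) :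
    SEWinner beats Finset.univ i := by
  classical
  set A : Finset V := Finset.univ.filter (fun u => beats i u) with hA
  set B : Finset V := Finset.univ.filter (fun u => beats u i) with hB
  have hdeg : ∀ j, ∑ u, M j u = 2 * (outDeg beats j : ℝ) - (Fintype.card V - 1) := by
    intro j
    have h1 : ∀ u, M j u = 2 * (if beats j u then (1 : ℝ) else 0) - 1 + (if u = j then 1 else 0) := by
      intro u
      rw [hM]
      by_cases hu : u = j
      · subst hu; simp [hT.irrefl]
      · rcases hT.total u j hu with h | h
        · have := hT.asymm _ _ h
          simp [h, this, hu]
        · simp [h, hu]; norm_num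
    have h2 : outDeg beats j = (Finset.univ.filter (fun u => beats j u)).card := by
      rw [outDeg, Set.ncard_eq_toFinset_card']
      congr 1
      ext; simp
    rw [Finset.sum_congr rfl (fun u _ => h1 u), h2]
    rw [Finset.sum_add_distrib, Finset.sum_sub_distrib, ← Finset.mul_sum, Finset.sum_boole]
    simp
    ring
  have hskew : ∀ u v, M u v = - M v u := by
    intro u v
    rw [hM, hM]
    by_cases h : beats u v
    · simp [h, hT.asymm _ _ h]
    · by_cases h' : beats v u <;> simp [h, h']
  have hzero : ∑ j, q j * ∑ u, q u * M u j = 0 := by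
    have h1 : ∑ j, q j * ∑ u, q u * M u j = ∑ j, ∑ u, q j * q u * M u j := by
      refine Finset.sum_congr rfl fun j _ => ?_
      rw [Finset.mul_sum]
      exact Finset.sum_congr rfl fun u _ => by ring
    have h2 : ∑ j, ∑ u, q j * q u * M u j = - ∑ j, ∑ u, q j * q u * M u j := by
      conv_lhs => rw [Finset.sum_comm]
      rw [← Finset.sum_neg_distrib]
      refine Finset.sum_congr rfl fun j _ => ?_
      rw [← Finset.sum_neg_distrib]
      refine Finset.sum_congr rfl fun u _ => ?_
      rw [hskew j u]; ring
    rw [h1]; linarith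
  have hci : ∑ u, q u * M u i = 0 := by
    have := (Finset.sum_eq_zero_iff_of_nonneg
      (fun j _ => mul_nonneg (hq0 j) (hml j))).mp hzero i (Finset.mem_univ i)
    rcases mul_eq_zero.mp this with h | h
    · exact absurd h hi.ne'
    · exact h
  have hking : ∀ b ∈ B, ∃ a ∈ A, beats a b := by
    intro b hb
    by_contra hcon
    push Not at hcon
    have hbi : beats b i := by simpa [hB] using hb
    have hib := hT.asymm _ _ hbi
    have h1 : ∀ u, q u * M u b ≤ q u * M u i - (if u = i then q i else 0) := by
      intro u
      by_cases hu : u = i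
      · subst hu
        simp [hM, hbi, hib, hT.irrefl]
      · simp only [hu, if_false, sub_zero]
        refine mul_le_mul_of_nonneg_left ?_ (hq0 u)
        rcases hT.total u i hu with h | h
        · rw [hM u i, if_pos h, hM]
          split_ifs <;> norm_num
        · have hub : ¬ beats u b := hcon u (by simp [hA, h])
          have hne : u ≠ b := fun e => hib (e ▸ h)
          have hbu : beats b u := (hT.total u b hne).resolve_left hub
          simp [hM, hub, hbu, h, hT.asymm _ _ h]
    have h2 := Finset.sum_le_sum (fun u (_ : u ∈ Finset.univ) => h1 u)
    rw [Finset.sum_sub_distrib, hci] at h2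
    simp at h2
    linarith [hml b]
  have hdi : 0 ≤ ∑ u, M i u := by
    have h1 : 0 ≤ ∑ j, q j * ∑ u, M j u := by
      have : ∑ j, q j * ∑ u, M j u = ∑ u, ∑ j, q j * M j u := by
        rw [Finset.sum_comm]
        exact Finset.sum_congr rfl fun j _ => by rw [Finset.mul_sum]
      rw [this]
      exact Finset.sum_nonneg fun u _ => hml u
    have h2 : ∑ j, q j * ∑ u, M j u ≤ ∑ j, q j * ∑ u, M i u := by
      refine Finset.sum_le_sum fun j _ => ?_
      rcases (hq0 j).eq_or_lt with h | h
      · simp [← h]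
      · refine mul_le_mul_of_nonneg_left ?_ h.le
        rw [hdeg, hdeg]
        have : (outDeg beats j : ℝ) ≤ outDeg beats i := by exact_mod_cast hmax j h
        linarith
    rw [← Finset.sum_mul, hq1, one_mul] at h2
    linarith
  have hle : B.card ≤ A.card := by
    have h1 : ∑ u, M i u = (A.card : ℝ) - B.card := by
      have : ∀ u, M i u = (if beats i u then (1 : ℝ) else 0) - (if beats u i then 1 else 0) := by
        intro u
        rw [hM]
        by_cases h : beats i u
        · simp [h, hT.asymm _ _ h]
        · by_cases h' : beats u i <;> simp [h, h']
      rw [Finset.sum_congr rfl (fun u _ => this u), Finset.sum_sub_distrib]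
      simp [hA, hB]
    rw [h1] at hdi
    have : (B.card : ℝ) ≤ A.card := by linarith
    exact_mod_cast this
  have hd : Disjoint A B := by
    rw [Finset.disjoint_left]
    intro x hx hx'
    simp only [hA, hB, Finset.mem_filter, Finset.mem_univ, true_and] at hx hx'
    exact hT.asymm _ _ hx hx'
  have hiA : i ∉ A := by simp [hA, hT.irrefl]
  have hiB : i ∉ B := by simp [hB, hT.irrefl]
  have huniv : insert i (A ∪ B) = Finset.univ := by
    ext x
    simp only [hA, hB, Finset.mem_insert, Finset.mem_union, Finset.mem_filter, Finset.mem_univ,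
      true_and, iff_true]
    by_cases hx : x = i
    · exact Or.inl hx
    · exact Or.inr (hT.total x i hx).symm
  have hc : A.card + B.card + 1 = 2 ^ k := by
    rw [← hcard, ← Finset.card_univ, ← huniv, Finset.card_insert_of_notMem (by simp [hiA, hiB]),
      Finset.card_union_of_disjoint hd]
  rw [← huniv]
  exact king_wins hT i k A B hd hiA hiB (fun a ha => by simpa [hA] using ha) hking hle hc
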